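/- Let (t_j) be a sequence of nonnegative reals and (c_j) complex numbers such that ∑_{|t_j| ≤ T} |c_j| ≪ T^{k+1+ε} for all T ≥ 1. Then for any fixed σ > 1/2, the sum ∑_j c_j·Γ(σ − 1/2 + it + it_j)·Γ(σ − 1/2 + it − it_j)/Γ(σ + it) converges absolutely for every real t, and its absolute value is bounded polynomially in (1 + |t|). -/

import Mathlib

open Real MeasureTheory

/-- The ratio `|Γ(a + it)| / Γ(a)` is nondecreasing in `a > 0`. -/
lemma norm_Gamma_mul_Gamma_add_le {a v : ℝ} (ha : 0 < a) (hv : 0 < v) (t : ℝ) :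
    ‖Complex.Gamma (a + t * Complex.I)‖ * Real.Gamma (a + v) ≤
      ‖Complex.Gamma ((a + v : ℝ) + t * Complex.I)‖ * Real.Gamma a := by
  set b : ℝ := ∫ x : ℝ in 0..1, x ^ (a - 1) * (1 - x) ^ (v - 1) with hb
  have hbeta : Complex.betaIntegral a v = b := by
    rw [Complex.betaIntegral, hb, ← intervalIntegral.integral_ofReal]
    refine intervalIntegral.integral_congr fun x hx => ?_
    rw [Set.uIcc_of_le zero_le_one] at hx
    simp only [Complex.ofReal_mul]
    rw [Complex.ofReal_cpow hx.1, Complex.ofReal_cpow (sub_nonneg.2 hx.2)]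
    push_cast
    rfl
  have hnorm : ‖Complex.betaIntegral (a + t * Complex.I) v‖ ≤ b := by
    refine (intervalIntegral.norm_integral_le_integral_norm zero_le_one).trans_eq ?_
    rw [hb, intervalIntegral.integral_of_le zero_le_one,
      intervalIntegral.integral_of_le zero_le_one, integral_Ioc_eq_integral_Ioo,
      integral_Ioc_eq_integral_Ioo]
    refine setIntegral_congr_fun measurableSet_Ioo fun x hx => ?_
    have h1 : (1 - (x : ℂ)) = ((1 - x : ℝ) : ℂ) := by push_cast; rfl
    rw [norm_mul, h1, Complex.norm_cpow_eq_rpow_re_of_pos hx.1,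
      Complex.norm_cpow_eq_rpow_re_of_pos (sub_pos.2 hx.2)]
    simp
  have h1 := Complex.Gamma_mul_Gamma_eq_betaIntegral (s := a + t * Complex.I) (t := v)
    (by simpa using ha) (by simpa using hv)
  have h2 : Real.Gamma a * Real.Gamma v = Real.Gamma (a + v) * b := by
    have := Complex.Gamma_mul_Gamma_eq_betaIntegral (s := a) (t := v)
      (by simpa using ha) (by simpa using hv)
    rw [hbeta, ← Complex.ofReal_add] at this
    simp only [Complex.Gamma_ofReal] at this
    exact_mod_cast this
  have h3 : ‖Complex.Gamma (a + t * Complex.I)‖ * Real.Gamma v ≤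
      ‖Complex.Gamma ((a + v : ℝ) + t * Complex.I)‖ * b := by
    have h4 := congrArg norm h1
    rw [norm_mul, norm_mul, Complex.Gamma_ofReal, Complex.norm_real,
      Real.norm_of_nonneg (Real.Gamma_pos_of_pos hv).le] at h4
    have h5 : (a : ℂ) + t * Complex.I + v = (a + v : ℝ) + t * Complex.I := by
      push_cast; ring
    rw [h4, h5]
    gcongr
  have hGv := Real.Gamma_pos_of_pos hv
  have hGav := Real.Gamma_pos_of_pos (add_pos ha hv)
  refine le_of_mul_le_mul_right ?_ hGv
  calc _ = (‖Complex.Gamma (a + t * Complex.I)‖ * Real.Gamma v) * Real.Gamma (a + v) := by ring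
    _ ≤ (‖Complex.Gamma ((a + v : ℝ) + t * Complex.I)‖ * b) * Real.Gamma (a + v) := by gcongr
    _ = ‖Complex.Gamma ((a + v : ℝ) + t * Complex.I)‖ * (Real.Gamma (a + v) * b) := by ring
    _ = _ := by rw [← h2]; ring

lemma norm_Gamma_half_sq (t : ℝ) :
    ‖Complex.Gamma ((1 / 2 : ℝ) + t * Complex.I)‖ ^ 2 = π / Real.cosh (π * t) := by
  have h := Complex.Gamma_mul_Gamma_one_sub ((1 / 2 : ℝ) + t * Complex.I)
  have h1 : (1 : ℂ) - ((1 / 2 : ℝ) + t * Complex.I) =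
      starRingEnd ℂ ((1 / 2 : ℝ) + t * Complex.I) := by
    apply Complex.ext <;> norm_num
  have h2 : Complex.sin (π * ((1 / 2 : ℝ) + t * Complex.I)) = (Real.cosh (π * t) : ℝ) := by
    have : (π : ℂ) * ((1 / 2 : ℝ) + t * Complex.I) = (π * t : ℝ) * Complex.I + π / 2 := by
      push_cast; ring
    rw [this, Complex.sin_add_pi_div_two, Complex.cos_mul_I, Complex.ofReal_cosh]
  rw [h1, Complex.Gamma_conj, Complex.mul_conj, h2, Complex.normSq_eq_norm_sq] at h
  exact_mod_cast h

lemma exp_le_norm_Gamma_half (t : ℝ) :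
    Real.exp (-(π / 2 * |t|)) ≤ ‖Complex.Gamma ((1 / 2 : ℝ) + t * Complex.I)‖ := by
  refine (sq_le_sq₀ (Real.exp_nonneg _) (norm_nonneg _)).1 ?_
  rw [norm_Gamma_half_sq, ← Real.exp_nat_mul, le_div_iff₀ (Real.cosh_pos _),
    ← Real.cosh_abs, abs_mul, abs_of_pos pi_pos]
  have h1 : Real.cosh (π * |t|) ≤ Real.exp (π * |t|) := by
    rw [Real.cosh_eq]
    have : Real.exp (-(π * |t|)) ≤ Real.exp (π * |t|) :=
      Real.exp_le_exp.2 (neg_le_self (by positivity))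
    linarith
  calc _ ≤ Real.exp ((2 : ℕ) * -(π / 2 * |t|)) * Real.exp (π * |t|) := by gcongr
    _ = 1 := by rw [← Real.exp_add, ← Real.exp_zero]; congr 1; push_cast; ring
    _ ≤ π := by linarith [pi_gt_three]

lemma norm_Gamma_half_le (t : ℝ) :
    ‖Complex.Gamma ((1 / 2 : ℝ) + t * Complex.I)‖ ≤ 3 * Real.exp (-(π / 2 * |t|)) := by
  refine (sq_le_sq₀ (norm_nonneg _) (by positivity)).1 ?_
  rw [norm_Gamma_half_sq, mul_pow, ← Real.exp_nat_mul, div_le_iff₀ (Real.cosh_pos _),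
    ← Real.cosh_abs, abs_mul, abs_of_pos pi_pos]
  have h1 : Real.exp (π * |t|) / 2 ≤ Real.cosh (π * |t|) := by
    rw [Real.cosh_eq]
    linarith [Real.exp_pos (-(π * |t|))]
  calc π ≤ 3 ^ 2 * (1 / 2) := by linarith [pi_lt_four]
    _ = 3 ^ 2 * Real.exp ((2 : ℕ) * -(π / 2 * |t|)) * (Real.exp (π * |t|) / 2) := by
        have : Real.exp ((2 : ℕ) * -(π / 2 * |t|)) * Real.exp (π * |t|) = 1 := by
          rw [← Real.exp_add, ← Real.exp_zero]; congr 1; push_cast; ring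
        linear_combination (-9 / 2) * this
    _ ≤ _ := by gcongr

lemma exists_norm_Gamma_half_add_nat_le (m : ℕ) :
    ∃ K : ℝ, 0 ≤ K ∧ ∀ t : ℝ, ‖Complex.Gamma ((1 / 2 + m : ℝ) + t * Complex.I)‖ ≤
      K * (1 + |t|) ^ m * Real.exp (-(π / 2 * |t|)) := by
  induction m with
  | zero => exact ⟨3, by norm_num, fun t => by simpa using norm_Gamma_half_le t⟩
  | succ m ih =>
    obtain ⟨K, hK, h⟩ := ih
    refine ⟨(m + 1) * K, by positivity, fun t => ?_⟩
    have hne : ((1 / 2 + m : ℝ) + t * Complex.I : ℂ) ≠ 0 := fun h0 => by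
      have := congrArg Complex.re h0
      simp at this
      linarith [(Nat.cast_nonneg m : (0 : ℝ) ≤ m)]
    have hs : (((1 / 2 + (m + 1 : ℕ) : ℝ)) + t * Complex.I : ℂ) =
        ((1 / 2 + m : ℝ) + t * Complex.I) + 1 := by push_cast; ring
    have hle : ‖((1 / 2 + m : ℝ) + t * Complex.I : ℂ)‖ ≤ (m + 1) * (1 + |t|) := by
      refine (norm_add_le _ _).trans ?_
      rw [norm_mul, Complex.norm_I, Complex.norm_real, Complex.norm_real, Real.norm_eq_abs,
        Real.norm_eq_abs, abs_of_pos (by positivity)]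
      nlinarith [abs_nonneg t, mul_nonneg (Nat.cast_nonneg m : (0 : ℝ) ≤ m) (abs_nonneg t)]
    rw [hs, Complex.Gamma_add_one _ hne, norm_mul]
    calc _ ≤ ((m + 1) * (1 + |t|)) * (K * (1 + |t|) ^ m * Real.exp (-(π / 2 * |t|))) := by
          gcongr
          exact h t
      _ = _ := by ring

/-- Exponential decay of `Γ` on vertical lines in the right half-plane. -/
lemma exists_norm_Gamma_le {a : ℝ} (ha : 0 < a) :
    ∃ K : ℝ, 0 ≤ K ∧ ∃ m : ℕ, ∀ t : ℝ, ‖Complex.Gamma (a + t * Complex.I)‖ ≤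
      K * (1 + |t|) ^ m * Real.exp (-(π / 2 * |t|)) := by
  obtain ⟨m, hm⟩ := exists_nat_gt a
  obtain ⟨K, hK, h⟩ := exists_norm_Gamma_half_add_nat_le m
  have hG := Real.Gamma_pos_of_pos ha
  have hG' : 0 < Real.Gamma (1 / 2 + m) := Real.Gamma_pos_of_pos (by positivity)
  refine ⟨K * Real.Gamma a / Real.Gamma (1 / 2 + m), by positivity, m, fun t => ?_⟩
  have h1 := norm_Gamma_mul_Gamma_add_le ha (v := 1 / 2 + m - a) (by linarith) t
  rw [add_sub_cancel] at h1
  rw [div_mul_eq_mul_div, div_mul_eq_mul_div, le_div_iff₀ hG']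
  calc _ ≤ _ := h1
    _ ≤ (K * (1 + |t|) ^ m * Real.exp (-(π / 2 * |t|))) * Real.Gamma a := by
        gcongr
        exact h t
    _ = _ := by ring

lemma exists_le_norm_Gamma {a : ℝ} (ha : 1 / 2 < a) :
    ∃ κ : ℝ, 0 < κ ∧ ∀ t : ℝ,
      κ * Real.exp (-(π / 2 * |t|)) ≤ ‖Complex.Gamma (a + t * Complex.I)‖ := by
  have hG : 0 < Real.Gamma a := Real.Gamma_pos_of_pos (by linarith)
  have hG' : 0 < Real.Gamma (1 / 2) := Real.Gamma_pos_of_pos (by norm_num)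
  refine ⟨Real.Gamma a / Real.Gamma (1 / 2), by positivity, fun t => ?_⟩
  have h1 := norm_Gamma_mul_Gamma_add_le (a := 1 / 2) (by norm_num) (v := a - 1 / 2)
    (by linarith) t
  rw [add_sub_cancel] at h1
  rw [div_mul_eq_mul_div, div_le_iff₀ hG']
  calc _ ≤ Real.Gamma a * ‖Complex.Gamma ((1 / 2 : ℝ) + t * Complex.I)‖ := by
        gcongr
        exact exp_le_norm_Gamma_half t
    _ ≤ _ := by rw [mul_comm]; exact h1

/-- The Gamma quotient is bounded polynomially in `t` and decays exponentially in `τ`. -/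
lemma exists_norm_Gamma_quotient_le {σ : ℝ} (hσ : 1 / 2 < σ) :
    ∃ K : ℝ, 0 ≤ K ∧ ∃ m : ℕ, ∀ t τ : ℝ, 0 ≤ τ →
      ‖Complex.Gamma ((σ : ℂ) - 1 / 2 + ((t : ℂ) + (τ : ℂ)) * Complex.I)‖ *
        ‖Complex.Gamma ((σ : ℂ) - 1 / 2 + ((t : ℂ) - (τ : ℂ)) * Complex.I)‖ /
        ‖Complex.Gamma ((σ : ℂ) + (t : ℂ) * Complex.I)‖ ≤
      K * (1 + |t|) ^ m * ((1 + τ) ^ m * Real.exp (-(π / 2 * τ))) := by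
  obtain ⟨K, hK, m, hup⟩ := exists_norm_Gamma_le (sub_pos.2 hσ)
  obtain ⟨κ, hκ, hlow⟩ := exists_le_norm_Gamma hσ
  refine ⟨K ^ 2 / κ, by positivity, m + m, fun t τ hτ => ?_⟩
  have key : ∀ x : ℝ, |x| ≤ |t| + τ →
      ‖Complex.Gamma ((σ : ℂ) - 1 / 2 + (x : ℂ) * Complex.I)‖ ≤
        K * ((1 + |t|) * (1 + τ)) ^ m * Real.exp (-(π / 2 * |x|)) := by
    intro x hx
    have h := hup x
    push_cast at h
    refine h.trans ?_
    gcongr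
    nlinarith [mul_nonneg (abs_nonneg t) hτ]
  have h1 := key (t + τ) ((abs_add_le t τ).trans_eq (by rw [abs_of_nonneg hτ]))
  have h2 := key (t - τ) ((abs_sub t τ).trans_eq (by rw [abs_of_nonneg hτ]))
  push_cast at h1 h2
  have hexp : -(π / 2 * |t + τ|) + -(π / 2 * |t - τ|) ≤ -(π / 2 * τ) + -(π / 2 * |t|) := by
    have : τ + |t| ≤ |t + τ| + |t - τ| := by
      cases abs_cases t <;> cases abs_cases (t + τ) <;> cases abs_cases (t - τ) <;> linarith
    nlinarith [pi_pos]
  have hpos := (mul_pos hκ (Real.exp_pos (-(π / 2 * |t|)))).trans_le (hlow t)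
  rw [div_le_iff₀ hpos]
  calc _ ≤ (K * ((1 + |t|) * (1 + τ)) ^ m * Real.exp (-(π / 2 * |t + τ|))) *
        (K * ((1 + |t|) * (1 + τ)) ^ m * Real.exp (-(π / 2 * |t - τ|))) := by gcongr
    _ = (K * ((1 + |t|) * (1 + τ)) ^ m) ^ 2 *
        Real.exp (-(π / 2 * |t + τ|) + -(π / 2 * |t - τ|)) := by rw [Real.exp_add]; ring
    _ ≤ (K * ((1 + |t|) * (1 + τ)) ^ m) ^ 2 *
        Real.exp (-(π / 2 * τ) + -(π / 2 * |t|)) := by gcongr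
    _ = K ^ 2 / κ * (1 + |t|) ^ (m + m) * ((1 + τ) ^ (m + m) * Real.exp (-(π / 2 * τ))) *
        (κ * Real.exp (-(π / 2 * |t|))) := by
        rw [Real.exp_add, mul_pow (1 + |t|)]; field_simp; ring
    _ ≤ _ := by
        gcongr
        exact hlow t

/-- Weights whose partial sums grow polynomially are summable against exponential decay. -/
lemma summable_mul_pow_mul_exp_of_partial_sums_le {w τ : ℕ → ℝ} (hw : ∀ j, 0 ≤ w j)
    (hτ : ∀ j, 0 ≤ τ j) {C D r : ℝ} (hr : 0 < r) (m : ℕ)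
    (hsummable : ∀ T : ℝ, 1 ≤ T → Summable (fun j => if τ j ≤ T then w j else 0))
    (hbound : ∀ T : ℝ, 1 ≤ T → (∑' j, if τ j ≤ T then w j else 0) ≤ C * T ^ D) :
    Summable fun j => w j * ((1 + τ j) ^ m * Real.exp (-(r * τ j))) := by
  obtain ⟨p, hp⟩ := exists_nat_ge D
  let g : ℕ → ℝ := fun n => (n + 2 : ℝ) ^ m * Real.exp (-(r * n))
  have hg : ∀ n, 0 ≤ g n := fun n => by positivity
  let F : ℕ × ℕ → ℝ := fun q => (if τ q.2 ≤ q.1 + 1 then w q.2 else 0) * g q.1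
  have hF0 : 0 ≤ F := fun q => mul_nonneg (by split_ifs; exacts [hw _, le_rfl]) (hg _)
  have hone : ∀ n : ℕ, (1 : ℝ) ≤ n + 1 := fun n => by simp
  have hF : Summable F := by
    refine (summable_prod_of_nonneg hF0).2
      ⟨fun n => (hsummable (n + 1) (hone n)).mul_right (g n), ?_⟩
    have hs : Summable fun n : ℕ =>
        |C| * Real.exp (2 * r) * (((n + 2 : ℕ) : ℝ) ^ (p + m) * Real.exp (-r * (n + 2 : ℕ))) :=
      ((summable_nat_add_iff (f := fun n : ℕ => (n : ℝ) ^ (p + m) * Real.exp (-r * n)) 2).2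
        (Real.summable_pow_mul_exp_neg_nat_mul (p + m) hr)).mul_left _
    refine hs.of_nonneg_of_le (fun n => tsum_nonneg fun j => hF0 (n, j)) fun n => ?_
    calc ∑' j, F (n, j) = (∑' j, if τ j ≤ n + 1 then w j else 0) * g n := by
          simp only [F]
          rw [tsum_mul_right]
      _ ≤ (C * (n + 1 : ℝ) ^ D) * g n := by
          gcongr
          exact hbound _ (hone n)
      _ ≤ (|C| * (n + 2 : ℝ) ^ p) * g n := by
          gcongr
          · exact le_abs_self C
          · calc (n + 1 : ℝ) ^ D ≤ (n + 1 : ℝ) ^ (p : ℝ) :=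
                  Real.rpow_le_rpow_of_exponent_le (hone n) hp
              _ = (n + 1 : ℝ) ^ p := Real.rpow_natCast _ _
              _ ≤ _ := by gcongr; norm_num
      _ = _ := by
          have : Real.exp (-(r * n)) = Real.exp (2 * r) * Real.exp (-r * (n + 2 : ℕ)) := by
            rw [← Real.exp_add]; congr 1; push_cast; ring
          simp only [g]
          rw [this]
          push_cast
          ring
  have hinj : Function.Injective fun j : ℕ => (⌊τ j⌋₊, j) := fun i j h => (Prod.ext_iff.1 h).2
  refine (hF.comp_injective hinj).of_nonneg_of_le
    (fun j => mul_nonneg (hw j) (by have := hτ j; positivity)) fun j => ?_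
  have h1 := (Nat.lt_floor_add_one (τ j)).le
  have h2 := Nat.floor_le (hτ j)
  have h3 := hτ j
  have h4 := hw j
  simp only [Function.comp, F, g, if_pos h1]
  gcongr _ * (?_ ^ m * Real.exp ?_)
  · linarith
  · exact neg_le_neg (mul_le_mul_of_nonneg_left h2 hr.le)

/-- Convergence of the discrete spectral expansion: if `∑_{t_j ≤ T} |c_j| ≪ T^{k+1+ε}`,
then for fixed `σ > 1/2` the sum
`∑_j c_j Γ(σ−1/2+it+it_j) Γ(σ−1/2+it−it_j) / Γ(σ+it)` converges absolutely for every
real `t`, and is bounded polynomially in `1 + |t|`. -/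
theorem discrete_spectrum_convergence (k ε σ C : ℝ) (hε : 0 < ε) (hσ : 1 / 2 < σ)
    (tj : ℕ → ℝ) (c : ℕ → ℂ) (htj : ∀ j, 0 ≤ tj j)
    (hsummable : ∀ T : ℝ, 1 ≤ T → Summable (fun j => if tj j ≤ T then ‖c j‖ else 0))
    (hbound : ∀ T : ℝ, 1 ≤ T →
      (∑' j, if tj j ≤ T then ‖c j‖ else 0) ≤ C * T ^ (k + 1 + ε)) :
    (∀ t : ℝ, Summable (fun j =>
      ‖c j * Complex.Gamma ((σ : ℂ) - 1 / 2 + ((t : ℂ) + (tj j : ℂ)) * Complex.I) *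
        Complex.Gamma ((σ : ℂ) - 1 / 2 + ((t : ℂ) - (tj j : ℂ)) * Complex.I) /
        Complex.Gamma ((σ : ℂ) + (t : ℂ) * Complex.I)‖)) ∧
    ∃ C' d : ℝ, ∀ t : ℝ,
      ‖∑' j, c j * Complex.Gamma ((σ : ℂ) - 1 / 2 + ((t : ℂ) + (tj j : ℂ)) * Complex.I) *
          Complex.Gamma ((σ : ℂ) - 1 / 2 + ((t : ℂ) - (tj j : ℂ)) * Complex.I) /
          Complex.Gamma ((σ : ℂ) + (t : ℂ) * Complex.I)‖
        ≤ C' * (1 + |t|) ^ d := by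
  obtain ⟨K, hK, m, hquot⟩ := exists_norm_Gamma_quotient_le hσ
  have hS := summable_mul_pow_mul_exp_of_partial_sums_le (fun j => norm_nonneg (c j)) htj
    (half_pos pi_pos) m hsummable hbound
  have hterm : ∀ (t : ℝ) (j : ℕ),
      ‖c j * Complex.Gamma ((σ : ℂ) - 1 / 2 + ((t : ℂ) + (tj j : ℂ)) * Complex.I) *
        Complex.Gamma ((σ : ℂ) - 1 / 2 + ((t : ℂ) - (tj j : ℂ)) * Complex.I) /
        Complex.Gamma ((σ : ℂ) + (t : ℂ) * Complex.I)‖ ≤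
      K * (1 + |t|) ^ m * (‖c j‖ * ((1 + tj j) ^ m * Real.exp (-(π / 2 * tj j)))) := by
    intro t j
    rw [norm_div, norm_mul, norm_mul, mul_assoc, mul_div_assoc]
    calc _ ≤ ‖c j‖ * (K * (1 + |t|) ^ m * ((1 + tj j) ^ m * Real.exp (-(π / 2 * tj j)))) := by
          gcongr
          exact hquot t (tj j) (htj j)
      _ = _ := by ring
  have habs := fun t : ℝ => (hS.mul_left (K * (1 + |t|) ^ m)).of_nonneg_of_le
    (fun j => norm_nonneg _) (hterm t)
  refine ⟨habs,
    K * ∑' j, ‖c j‖ * ((1 + tj j) ^ m * Real.exp (-(π / 2 * tj j))), m, fun t => ?_⟩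
  refine (norm_tsum_le_tsum_norm (habs t)).trans ?_
  refine ((habs t).tsum_le_tsum (hterm t) (hS.mul_left _)).trans_eq ?_
  rw [tsum_mul_left, Real.rpow_natCast]
  ring
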